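/- If H is a 4-uniform hypergraph on n vertices containing no copy of C^(4)_r (r ≥ 3), then e(H) ≤ (r-2)/(2(r-1)) * binom(n,2)^2 / 3; in particular the Turán density of C^(4)_r is at most (r-2)/(r-1). -/

import Mathlib

open Finset in
/-- **Turán's theorem** with the divisibility corrections dropped. -/
theorem SimpleGraph.CliqueFree.mul_card_edgeFinset_le {W : Type*} [Fintype W]
    {G : SimpleGraph W} [DecidableRel G.Adj] {k : ℕ} (hk : 0 < k) (cf : G.CliqueFree (k + 1)) :
    2 * k * #G.edgeFinset ≤ (k - 1) * Fintype.card W ^ 2 := by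
  obtain ⟨T, _, hT⟩ := SimpleGraph.exists_isTuranMaximal (V := W) hk
  obtain ⟨f⟩ := hT.nonempty_iso_turanGraph
  calc 2 * k * #G.edgeFinset ≤ 2 * k * #T.edgeFinset := Nat.mul_le_mul_left _ (hT.2 cf)
    _ = 2 * k * #(SimpleGraph.turanGraph (Fintype.card W) k).edgeFinset := by
      rw [f.card_edgeFinset_eq]
    _ ≤ _ := SimpleGraph.mul_card_edgeFinset_turanGraph_le

/-- The graph on the 2-subsets of `V` in which two disjoint pairs are adjacent
iff their union is an edge of `H`. -/
def pairGraph {V : Type*} [DecidableEq V] (H : Finset (Finset V)) :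
    SimpleGraph {p : Finset V // p.card = 2} where
  Adj p q := Disjoint p.1 q.1 ∧ p.1 ∪ q.1 ∈ H
  symm := ⟨fun p q h => ⟨h.1.symm, Finset.union_comm p.1 q.1 ▸ h.2⟩⟩
  loopless := ⟨fun p h => by
    have h0 := disjoint_self.mp h.1
    have h2 := p.2
    simp [h0] at h2⟩

instance {V : Type*} [DecidableEq V] (H : Finset (Finset V)) :
    DecidableRel (pairGraph H).Adj :=
  fun p q => inferInstanceAs (Decidable (Disjoint p.1 q.1 ∧ p.1 ∪ q.1 ∈ H))

/-- Every 4-set splits into two pairs in three ways. -/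
theorem three_mul_card_le_card_edgeFinset_pairGraph {V : Type*} [Fintype V] [DecidableEq V]
    {H : Finset (Finset V)} (hH : ∀ e ∈ H, e.card = 4) :
    3 * H.card ≤ (pairGraph H).edgeFinset.card := by
  have hsigma : (H.sigma fun e => e.powersetCard 2).card = 6 * H.card := by
    rw [Finset.card_sigma, Finset.sum_congr rfl (g := fun _ => 6), Finset.sum_const,
      smul_eq_mul, mul_comm]
    intro e he
    rw [Finset.card_powersetCard, hH e he]
    rfl
  have hle : (H.sigma fun e => e.powersetCard 2).card ≤ Fintype.card (pairGraph H).Dart := by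
    rw [← Finset.card_univ]
    refine Finset.card_le_card_of_surjOn (fun d => ⟨d.fst.1 ∪ d.snd.1, d.fst.1⟩) ?_
    rintro ⟨e, p⟩ hx
    simp only [Finset.coe_sigma, Set.mem_sigma_iff, Finset.mem_coe,
      Finset.mem_powersetCard] at hx
    obtain ⟨he, hpe, hp⟩ := hx
    have hunion : p ∪ e \ p = e := Finset.union_sdiff_of_subset hpe
    have hcard : (e \ p).card = 2 := by
      rw [Finset.card_sdiff_of_subset hpe, hH e he, hp]
    refine ⟨⟨(⟨p, hp⟩, ⟨e \ p, hcard⟩), Finset.disjoint_sdiff, ?_⟩, by simp, ?_⟩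
    · simpa only [hunion] using he
    · simp only [hunion]
  rw [hsigma, SimpleGraph.dart_card_eq_twice_card_edges] at hle
  lia

/-- a 4-uniform hypergraph on `n` vertices with no copy of `C^(4)_r`
(`r ≥ 3`) has at most `(r-2)/(2(r-1)) * binom(n,2)² / 3` edges. -/
theorem stmt_17 {V : Type*} [Fintype V] [DecidableEq V] (r : ℕ) (hr : 3 ≤ r)
    (H : Finset (Finset V)) (hH : ∀ e ∈ H, e.card = 4)
    (hfree : ¬ ∃ P : Fin r → Finset V,
      (∀ i, (P i).card = 2) ∧ (∀ i j, i ≠ j → Disjoint (P i) (P j)) ∧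
      (∀ i j, i ≠ j → (P i ∪ P j) ∈ H)) :
    (H.card : ℝ) ≤
      ((r : ℝ) - 2) / (2 * ((r : ℝ) - 1)) * ((Fintype.card V).choose 2 : ℝ) ^ 2 / 3 := by
  obtain ⟨k, rfl⟩ : ∃ k, r = k + 1 + 1 := ⟨r - 2, by lia⟩
  have hcf : (pairGraph H).CliqueFree (k + 1 + 1) := by
    rw [SimpleGraph.cliqueFree_iff]
    refine ⟨fun f => hfree ⟨fun i => (f i).1, fun i => (f i).2, ?_, ?_⟩⟩
    · exact fun i j hij => (f.toHom.map_adj (v := i) (w := j) hij).1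
    · exact fun i j hij => (f.toHom.map_adj (v := i) (w := j) hij).2
  have hturan := hcf.mul_card_edgeFinset_le k.succ_pos
  have hthree := three_mul_card_le_card_edgeFinset_pairGraph hH
  rw [Fintype.card_finset_len, Nat.succ_sub_one] at hturan
  have hmain : 2 * (k + 1) * (3 * H.card) ≤ k * (Fintype.card V).choose 2 ^ 2 :=
    (Nat.mul_le_mul_left _ hthree).trans hturan
  have hreal : 2 * ((k : ℝ) + 1) * (3 * H.card) ≤ k * ((Fintype.card V).choose 2 : ℝ) ^ 2 := by
    exact_mod_cast hmain
  have hrhs : (((k + 1 + 1 : ℕ) : ℝ) - 2) / (2 * (((k + 1 + 1 : ℕ) : ℝ) - 1)) *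
      ((Fintype.card V).choose 2 : ℝ) ^ 2 / 3 =
      k * ((Fintype.card V).choose 2 : ℝ) ^ 2 / (2 * ((k : ℝ) + 1) * 3) := by
    have h2 : ((k + 1 + 1 : ℕ) : ℝ) - 2 = k := by push_cast; ring
    have h1 : ((k + 1 + 1 : ℕ) : ℝ) - 1 = k + 1 := by push_cast; ring
    rw [h1, h2]
    field_simp
  rw [hrhs, le_div_iff₀ (by positivity)]
  linarith
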